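/- arXiv:2412.10708 — 3 statements merged into one kernel-verified Lean document; each statement's English description precedes it below -/
import Mathlib

section
/- Existence theorem for lightcone framed curves: for every smooth map (κ₁,κ₂,κ₃,α,β) : I → ℝ⁵ on an open interval I, there exists a lightcone framed curve (γ,ℓ⁺,ℓ⁻) : I → ℝ³₁ × Δ₄ whose lightcone curvature is (κ₁,κ₂,κ₃,α,β). -/
open Matrix

noncomputable section

/-- The Minkowski pseudo-scalar product on `ℝ³`:
`⟨x,y⟩ = −x₁y₁ + x₂y₂ + x₃y₃`. -/
def mdot (x y : Fin 3 → ℝ) : ℝ := -(x 0 * y 0) + x 1 * y 1 + x 2 * y 2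

/-- The pseudo vector product `x ∧ y` on Minkowski `ℝ³`, i.e. the determinant of the
matrix with rows `(−e₁, e₂, e₃)`, `x`, `y`. -/
def mcross (x y : Fin 3 → ℝ) : Fin 3 → ℝ :=
  ![-(x 1 * y 2 - x 2 * y 1), x 2 * y 0 - x 0 * y 2, x 0 * y 1 - x 1 * y 0]

/-- The (punctured) lightcone `LC* = {x ≠ 0 : ⟨x,x⟩ = 0}`. -/
def LCstar (x : Fin 3 → ℝ) : Prop := x ≠ 0 ∧ mdot x x = 0

/-- Membership in `Δ₄ = {(v,w) ∈ LC* × LC* : ⟨v,w⟩ = −2}`. -/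
def MemDelta4 (v w : Fin 3 → ℝ) : Prop := LCstar v ∧ LCstar w ∧ mdot v w = -2

/-- `n(t) = −(1/2) ℓ⁺(t) ∧ ℓ⁻(t)`. -/
def lcn (lp lm : ℝ → Fin 3 → ℝ) : ℝ → Fin 3 → ℝ :=
  fun t => (-(1/2) : ℝ) • mcross (lp t) (lm t)

/-- Smoothness (on `I`) of a real valued function. -/
def Smooth1 (I : Set ℝ) (f : ℝ → ℝ) : Prop := ContDiffOn ℝ (⊤ : ℕ∞) f I

/-- Smoothness (on `I`) of an `ℝ³`-valued function. -/
def Smooth3 (I : Set ℝ) (f : ℝ → Fin 3 → ℝ) : Prop := ContDiffOn ℝ (⊤ : ℕ∞) f I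

/-- `λ ≢ 0` : the set where `λ` is non-zero is dense in `I`. -/
def NotIdentZero (I : Set ℝ) (f : ℝ → ℝ) : Prop :=
  I ⊆ closure {t | t ∈ I ∧ f t ≠ 0}

/-- A lightcone framed curve `(γ, ℓ⁺, ℓ⁻) : I → ℝ³₁ × Δ₄`. -/
structure IsLightconeFramedCurve (I : Set ℝ) (γ lp lm : ℝ → Fin 3 → ℝ) : Prop where
  smooth_base : Smooth3 I γ
  smooth_lp : Smooth3 I lp
  smooth_lm : Smooth3 I lm
  delta4 : ∀ t ∈ I, MemDelta4 (lp t) (lm t)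
  exists_coeffs : ∃ α β : ℝ → ℝ, Smooth1 I α ∧ Smooth1 I β ∧
    ∀ t ∈ I, deriv γ t = α t • lp t + β t • lm t

/-- `(κ₁, κ₂, κ₃, α, β)` is the lightcone curvature of the lightcone framed curve
`(γ, ℓ⁺, ℓ⁻)`. -/
structure HasLightconeCurvature (I : Set ℝ) (γ lp lm : ℝ → Fin 3 → ℝ)
    (κ₁ κ₂ κ₃ α β : ℝ → ℝ) : Prop where
  smooth_κ₁ : Smooth1 I κ₁
  smooth_κ₂ : Smooth1 I κ₂
  smooth_κ₃ : Smooth1 I κ₃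
  smooth_α : Smooth1 I α
  smooth_β : Smooth1 I β
  deriv_lp : ∀ t ∈ I, deriv lp t = κ₁ t • lp t + (2 * κ₃ t) • lcn lp lm t
  deriv_lm : ∀ t ∈ I, deriv lm t = (-κ₁ t) • lm t + (2 * κ₂ t) • lcn lp lm t
  deriv_n : ∀ t ∈ I, deriv (lcn lp lm) t = κ₂ t • lp t + κ₃ t • lm t
  deriv_base : ∀ t ∈ I, deriv γ t = α t • lp t + β t • lm t

/-- The vector field `ℓ⁺` built from a lightcone frame. -/
def fieldLp (lp lm : ℝ → Fin 3 → ℝ) : ℝ → Fin 3 → ℝ := fun t => lp t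
/-- The vector field `ℓ⁻` built from a lightcone frame. -/
def fieldLm (lp lm : ℝ → Fin 3 → ℝ) : ℝ → Fin 3 → ℝ := fun t => lm t
/-- `nᵀ = (ℓ⁺ + ℓ⁻)/2`. -/
def fieldNT (lp lm : ℝ → Fin 3 → ℝ) : ℝ → Fin 3 → ℝ := fun t => (1/2 : ℝ) • (lp t + lm t)
/-- `nˢ = (ℓ⁺ − ℓ⁻)/2`. -/
def fieldNS (lp lm : ℝ → Fin 3 → ℝ) : ℝ → Fin 3 → ℝ := fun t => (1/2 : ℝ) • (lp t - lm t)
/-- `n = −(1/2) ℓ⁺ ∧ ℓ⁻`. -/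
def fieldN (lp lm : ℝ → Fin 3 → ℝ) : ℝ → Fin 3 → ℝ := lcn lp lm
/-- `ℓ̃⁺ = nᵀ + n`. -/
def fieldLtp (lp lm : ℝ → Fin 3 → ℝ) : ℝ → Fin 3 → ℝ :=
  fun t => fieldNT lp lm t + fieldN lp lm t
/-- `ℓ̃⁻ = nᵀ − n`. -/
def fieldLtm (lp lm : ℝ → Fin 3 → ℝ) : ℝ → Fin 3 → ℝ :=
  fun t => fieldNT lp lm t - fieldN lp lm t

/-- `(γ,ℓ⁺,ℓ⁻)` and `(γ̄,ℓ̄⁺,ℓ̄⁻)` are `(v,w̄)`-mates. -/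
def AreMates (I : Set ℝ)
    (v w : (ℝ → Fin 3 → ℝ) → (ℝ → Fin 3 → ℝ) → ℝ → Fin 3 → ℝ)
    (γ lp lm γ' lp' lm' : ℝ → Fin 3 → ℝ) : Prop :=
  IsLightconeFramedCurve I γ lp lm ∧ IsLightconeFramedCurve I γ' lp' lm' ∧
  ∃ lam : ℝ → ℝ, Smooth1 I lam ∧ NotIdentZero I lam ∧
    (∀ t ∈ I, γ' t = γ t + lam t • v lp lm t) ∧
    (∀ t ∈ I, v lp lm t = w lp' lm' t)

/-- `(γ,ℓ⁺,ℓ⁻)` is a `(v,w̄)`-Bertrand lightcone framed curve. -/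
def IsBertrand (I : Set ℝ)
    (v w : (ℝ → Fin 3 → ℝ) → (ℝ → Fin 3 → ℝ) → ℝ → Fin 3 → ℝ)
    (γ lp lm : ℝ → Fin 3 → ℝ) : Prop :=
  ∃ γ' lp' lm' : ℝ → Fin 3 → ℝ, AreMates I v w γ lp lm γ' lp' lm'

/-- Two-sided Grönwall inequality. -/
lemma norm_le_norm_mul_exp_of_norm_deriv_le {E : Type*} [NormedAddCommGroup E] [NormedSpace ℝ E]
    {f f' : ℝ → E} {a b K t₀ t : ℝ}
    (hf : ∀ s ∈ Set.Icc a b, HasDerivWithinAt f (f' s) (Set.Icc a b) s)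
    (bound : ∀ s ∈ Set.Icc a b, ‖f' s‖ ≤ K * ‖f s‖)
    (ht₀ : t₀ ∈ Set.Icc a b) (ht : t ∈ Set.Icc a b) :
    ‖f t‖ ≤ ‖f t₀‖ * Real.exp (K * |t - t₀|) := by
  rcases le_total t₀ t with h | h
  · have hsub : Set.Icc t₀ b ⊆ Set.Icc a b := Set.Icc_subset_Icc_left ht₀.1
    have key := norm_le_gronwallBound_of_norm_deriv_right_le (f := f) (f' := f') (K := K) (ε := 0)
      (fun s hs ↦ ((hf s (hsub hs)).continuousWithinAt).mono hsub)
      (fun s hs ↦ ((hf s (hsub (Set.Ico_subset_Icc_self hs))).mono hsub).mono_of_mem_nhdsWithin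
        (Icc_mem_nhdsGE_of_mem hs)) le_rfl
      (fun s hs ↦ by simpa using bound s (hsub (Set.Ico_subset_Icc_self hs))) t ⟨h, ht.2⟩
    rwa [gronwallBound_ε0, ← abs_of_nonneg (sub_nonneg.2 h)] at key
  · have hmaps : Set.MapsTo (fun s : ℝ ↦ -s) (Set.Icc (-t₀) (-a)) (Set.Icc a b) := fun s hs ↦
      ⟨by linarith [hs.2], by linarith [hs.1, ht₀.2]⟩
    have hd : ∀ s ∈ Set.Icc (-t₀) (-a), HasDerivWithinAt (fun s ↦ f (-s)) (-f' (-s))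
        (Set.Icc (-t₀) (-a)) s := fun s hs ↦ by
      simpa [Function.comp_def] using (hf (-s) (hmaps hs)).scomp s (hasDerivAt_neg s).hasDerivWithinAt hmaps
    have key := norm_le_gronwallBound_of_norm_deriv_right_le (f := fun s ↦ f (-s))
      (f' := fun s ↦ -f' (-s)) (K := K) (ε := 0)
      (fun s hs ↦ (hd s hs).continuousWithinAt)
      (fun s hs ↦ (hd s (Set.Ico_subset_Icc_self hs)).mono_of_mem_nhdsWithin
        (Icc_mem_nhdsGE_of_mem hs)) le_rfl
      (fun s hs ↦ by simpa using bound (-s) (hmaps (Set.Ico_subset_Icc_self hs)))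
      (-t) ⟨by linarith, by linarith [ht.1]⟩
    rw [gronwallBound_ε0] at key
    rw [abs_of_nonpos (sub_nonpos.2 h)]
    simpa [neg_add_eq_sub] using key

/-- A solution of a linear ODE which vanishes at one point vanishes identically. -/
lemma eq_zero_of_linear_ode {E : Type*} [NormedAddCommGroup E] [NormedSpace ℝ E]
    {J : Set ℝ} (hJ : J.OrdConnected) {A : ℝ → E →L[ℝ] E} (hA : ContinuousOn A J) {x : ℝ → E}
    (hx : ∀ t ∈ J, HasDerivAt x (A t (x t)) t) {t₀ : ℝ} (ht₀ : t₀ ∈ J) (h₀ : x t₀ = 0)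
    {t : ℝ} (ht : t ∈ J) : x t = 0 := by
  have hsub : Set.uIcc t₀ t ⊆ J := hJ.uIcc_subset ht₀ ht
  obtain ⟨K, hK⟩ := isCompact_uIcc.exists_bound_of_continuousOn (hA.mono hsub)
  have key := norm_le_norm_mul_exp_of_norm_deriv_le (f := x) (f' := fun s ↦ A s (x s)) (K := K)
    (fun s hs ↦ (hx s (hsub hs)).hasDerivWithinAt)
    (fun s hs ↦ (A s).le_of_opNorm_le (hK s hs) _) Set.left_mem_uIcc Set.right_mem_uIcc
  simpa [h₀] using key

/-- A linear ODE in `ℝ^ι` has a solution on any compact interval on which its coefficients are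
continuous. -/
lemma exists_linear_ode_solution_Icc {ι : Type*} [Fintype ι] {a b t₀ : ℝ}
    {A : ℝ → (ι → ℝ) →L[ℝ] (ι → ℝ)} (hA : ContinuousOn A (Set.Icc a b))
    (ht₀ : t₀ ∈ Set.Icc a b) (x₀ : ι → ℝ) :
    ∃ x : ℝ → ι → ℝ, x t₀ = x₀ ∧
      ∀ t ∈ Set.Icc a b, HasDerivWithinAt x (A t (x t)) (Set.Icc a b) t := by
  obtain ⟨C, hC⟩ := isCompact_Icc.exists_bound_of_continuousOn hA
  have hC₀ : 0 ≤ C := (norm_nonneg _).trans (hC t₀ ht₀)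
  lift C to NNReal using hC₀
  have hab : 0 ≤ b - a := by linarith [ht₀.1, ht₀.2]
  obtain ⟨R, hR⟩ : ∃ R : NNReal, (R : ℝ) = ‖x₀‖ * Real.exp (C * (b - a)) :=
    ⟨⟨_, by positivity⟩, rfl⟩
  -- truncating the vector field outside the cube of radius `R` makes it bounded
  let ρ : (ι → ℝ) → ι → ℝ := fun x i ↦ max (-R) (min R (x i))
  have hρL : LipschitzWith 1 ρ := LipschitzWith.of_dist_le_mul fun x y ↦ by
    rw [NNReal.coe_one, one_mul]
    refine (dist_pi_le_iff dist_nonneg).2 fun i ↦ ?_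
    refine le_trans ?_ (dist_le_pi_dist x y i)
    simpa using (((LipschitzWith.id (α := ℝ)).const_min (R : ℝ)).const_max (-(R : ℝ))).dist_le_mul
      (x i) (y i)
  have hρR : ∀ x, ‖ρ x‖ ≤ R := fun x ↦ (pi_norm_le_iff_of_nonneg R.2).2 fun i ↦
    abs_le.2 ⟨le_max_left _ _, max_le (by linarith [R.2]) (min_le_left _ _)⟩
  have hρ0 : ρ 0 = 0 := by ext i; simp [ρ]
  have hρn : ∀ x, ‖ρ x‖ ≤ ‖x‖ := fun x ↦ by
    simpa [hρ0, dist_eq_norm] using hρL.dist_le_mul x 0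
  have hρid : ∀ x, ‖x‖ ≤ R → ρ x = x := fun x hx ↦ by
    ext i
    have h := abs_le.1 ((norm_le_pi_norm x i).trans hx)
    simp [ρ, h.1, h.2]
  obtain ⟨T, hT⟩ : ∃ T : NNReal, (T : ℝ) = b - a := ⟨⟨_, hab⟩, rfl⟩
  have hPL : IsPicardLindelof (fun t x ↦ A t (ρ x)) ⟨t₀, ht₀⟩ x₀ (C * R * T) 0 (C * R) C := by
    refine ⟨fun t ht ↦ ?_, fun x _ ↦ ?_, fun t ht x _ ↦ ?_, ?_⟩
    · have h := ((A t).lipschitz.weaken (show ‖A t‖₊ ≤ C from hC t ht)).comp hρL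
      rw [mul_one] at h
      exact h.lipschitzOnWith
    · exact hA.clm_apply continuousOn_const
    · exact (A t).le_of_opNorm_le_of_le (hC t ht) (hρR x)
    · simp only [NNReal.coe_mul, NNReal.coe_zero, sub_zero, hT]
      gcongr
      exact max_le (by linarith [ht₀.1]) (by linarith [ht₀.2])
  obtain ⟨x, hx₀, hx⟩ := hPL.exists_eq_forall_mem_Icc_hasDerivWithinAt₀
  refine ⟨x, hx₀, fun t ht ↦ ?_⟩
  have hb : ‖x t‖ ≤ R := by
    refine (norm_le_norm_mul_exp_of_norm_deriv_le (K := C) hx (fun s hs ↦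
      (A s).le_of_opNorm_le_of_le (hC s hs) (hρn _)) ht₀ ht).trans ?_
    rw [hR]
    change ‖x (⟨t₀, ht₀⟩ : Set.Icc a b)‖ * _ ≤ _
    rw [hx₀]
    gcongr
    exact abs_le.2 ⟨by linarith [ht.1, ht₀.2], by linarith [ht.2, ht₀.1]⟩
  simpa [hρid _ hb] using hx t ht

/-- A linear ODE in `ℝ^ι` has a global solution on any open interval on which its coefficients are
continuous. -/
lemma exists_linear_ode_solution {ι : Type*} [Fintype ι] {I : Set ℝ} (hIo : IsOpen I)
    (hIc : I.OrdConnected) {A : ℝ → (ι → ℝ) →L[ℝ] (ι → ℝ)} (hA : ContinuousOn A I)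
    {t₀ : ℝ} (ht₀ : t₀ ∈ I) (x₀ : ι → ℝ) :
    ∃ x : ℝ → ι → ℝ, x t₀ = x₀ ∧ ∀ t ∈ I, HasDerivAt x (A t (x t)) t := by
  have hloc : ∀ t ∈ I, ∃ J : Set ℝ, IsOpen J ∧ J.OrdConnected ∧ J ⊆ I ∧ t₀ ∈ J ∧ t ∈ J ∧
      ∃ y : ℝ → ι → ℝ, y t₀ = x₀ ∧ ∀ s ∈ J, HasDerivAt y (A s (y s)) s := by
    intro t ht
    have hend : ∀ s ∈ I, ∃ l ∈ I, ∃ u ∈ I, l < s ∧ s < u := fun s hs ↦ by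
      obtain ⟨l, hl, hls⟩ := ((Filter.Eventually.filter_mono nhdsWithin_le_nhds
        (hIo.eventually_mem hs)).and (self_mem_nhdsWithin (s := Set.Iio s) (a := s))).exists
      obtain ⟨u, hu, hus⟩ := ((Filter.Eventually.filter_mono nhdsWithin_le_nhds
        (hIo.eventually_mem hs)).and (self_mem_nhdsWithin (s := Set.Ioi s) (a := s))).exists
      exact ⟨l, hl, u, hu, hls, hus⟩
    obtain ⟨a, ha, -, -, haI, -⟩ := hend (min t₀ t) (min_rec' (· ∈ I) ht₀ ht)
    obtain ⟨-, -, b, hb, -, hbI⟩ := hend (max t₀ t) (max_rec' (· ∈ I) ht₀ ht)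
    rw [lt_min_iff] at haI
    rw [max_lt_iff] at hbI
    have hsub : Set.Icc a b ⊆ I := hIc.out ha hb
    obtain ⟨y, hy₀, hy⟩ := exists_linear_ode_solution_Icc (hA.mono hsub)
      (t₀ := t₀) ⟨haI.1.le, hbI.1.le⟩ x₀
    exact ⟨Set.Ioo a b, isOpen_Ioo, Set.ordConnected_Ioo, Set.Ioo_subset_Icc_self.trans hsub,
      ⟨haI.1, hbI.1⟩, ⟨haI.2, hbI.2⟩, y, hy₀, fun s hs ↦
      (hy s (Set.Ioo_subset_Icc_self hs)).hasDerivAt (Icc_mem_nhds hs.1 hs.2)⟩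
  choose! J hJo hJc hJI hJ₀ hJt y hy₀ hy using hloc
  have heq : ∀ t ∈ I, ∀ s ∈ J t, y s s = y t s := fun t ht s hs ↦ by
    have hsI := hJI t ht hs
    refine sub_eq_zero.1 (eq_zero_of_linear_ode (J := J s ∩ J t) (x := fun r ↦ y s r - y t r)
      ((hJc s hsI).inter (hJc t ht)) (hA.mono (Set.inter_subset_right.trans (hJI t ht)))
      (fun r hr ↦ ?_) ⟨hJ₀ s hsI, hJ₀ t ht⟩ (by simp [hy₀ s hsI, hy₀ t ht]) ⟨hJt s hsI, hs⟩)
    rw [map_sub]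
    exact (hy s hsI r hr.1).sub (hy t ht r hr.2)
  refine ⟨fun t ↦ y t t, hy₀ t₀ ht₀, fun t ht ↦ ?_⟩
  exact (hy t ht t (hJt t ht)).congr_of_eventuallyEq
    (((hJo t ht).eventually_mem (hJt t ht)).mono fun s hs ↦ heq t ht s hs)

/-- Solutions of linear ODEs with smooth coefficients are smooth. -/
lemma contDiffOn_of_linear_ode {E : Type*} [NormedAddCommGroup E] [NormedSpace ℝ E]
    {I : Set ℝ} (hIo : IsOpen I) {A : ℝ → E →L[ℝ] E} (hA : ContDiffOn ℝ (⊤ : ℕ∞) A I)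
    {x : ℝ → E} (hx : ∀ t ∈ I, HasDerivAt x (A t (x t)) t) :
    ContDiffOn ℝ (⊤ : ℕ∞) x I := by
  refine contDiffOn_infty.2 fun n ↦ ?_
  induction n with
  | zero => exact contDiffOn_zero.2 fun t ht ↦ (hx t ht).continuousAt.continuousWithinAt
  | succ n ih =>
    rw [Nat.cast_add, Nat.cast_one]
    refine (contDiffOn_succ_iff_deriv_of_isOpen hIo).2
      ⟨fun t ht ↦ (hx t ht).differentiableAt.differentiableWithinAt, fun h ↦ absurd h (WithTop.coe_ne_top), ?_⟩
    exact ((contDiffOn_infty.1 hA n).clm_apply ih).congr fun t ht ↦ (hx t ht).deriv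

/-- The coefficients of the linear ODE satisfied by the coordinates of `(ℓ⁺, ℓ⁻, n, γ)`. -/
def frameField (κ₁ κ₂ κ₃ α β : ℝ → ℝ) (t : ℝ) : (Fin 4 → ℝ) →L[ℝ] (Fin 4 → ℝ) :=
  LinearMap.toContinuousLinearMap (Matrix.toLin'
    !![κ₁ t, 0, 2 * κ₃ t, 0; 0, -κ₁ t, 2 * κ₂ t, 0; κ₂ t, κ₃ t, 0, 0; α t, β t, 0, 0])

lemma frameField_apply (κ₁ κ₂ κ₃ α β : ℝ → ℝ) (t : ℝ) (x : Fin 4 → ℝ) :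
    frameField κ₁ κ₂ κ₃ α β t x = ![κ₁ t * x 0 + 2 * κ₃ t * x 2, -κ₁ t * x 1 + 2 * κ₂ t * x 2,
      κ₂ t * x 0 + κ₃ t * x 1, α t * x 0 + β t * x 1] := by
  ext i
  fin_cases i <;> simp [frameField, Matrix.mulVec, dotProduct, Fin.sum_univ_four]

lemma contDiffOn_frameField {I : Set ℝ} {κ₁ κ₂ κ₃ α β : ℝ → ℝ}
    (hκ₁ : Smooth1 I κ₁) (hκ₂ : Smooth1 I κ₂) (hκ₃ : Smooth1 I κ₃)
    (hα : Smooth1 I α) (hβ : Smooth1 I β) :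
    ContDiffOn ℝ (⊤ : ℕ∞) (frameField κ₁ κ₂ κ₃ α β) I := by
  unfold Smooth1 at *
  refine contDiffOn_clm_apply.2 fun x ↦ contDiffOn_pi.2 fun i ↦ ?_
  simp only [frameField_apply]
  fin_cases i <;> simp <;> fun_prop

/-- A solution of the frame equations. -/
structure IsFrameSolution (I : Set ℝ) (κ₁ κ₂ κ₃ : ℝ → ℝ) (p m n : ℝ → Fin 3 → ℝ) : Prop where
  hasDerivAt_p : ∀ t ∈ I, ∀ i, HasDerivAt (p · i) (κ₁ t * p t i + 2 * κ₃ t * n t i) t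
  hasDerivAt_m : ∀ t ∈ I, ∀ i, HasDerivAt (m · i) (-κ₁ t * m t i + 2 * κ₂ t * n t i) t
  hasDerivAt_n : ∀ t ∈ I, ∀ i, HasDerivAt (n · i) (κ₂ t * p t i + κ₃ t * m t i) t

/-- A solution of the frame equations which vanishes at one point vanishes identically. -/
lemma IsFrameSolution.eq_zero {I : Set ℝ} (hIc : I.OrdConnected) {κ₁ κ₂ κ₃ : ℝ → ℝ}
    (hκ₁ : Smooth1 I κ₁) (hκ₂ : Smooth1 I κ₂) (hκ₃ : Smooth1 I κ₃) {p m n : ℝ → Fin 3 → ℝ}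
    (h : IsFrameSolution I κ₁ κ₂ κ₃ p m n) {t₀ : ℝ} (ht₀ : t₀ ∈ I)
    (hp : p t₀ = 0) (hm : m t₀ = 0) (hn : n t₀ = 0) {t : ℝ} (ht : t ∈ I) :
    p t = 0 ∧ m t = 0 ∧ n t = 0 := by
  have key : ∀ i, (![p t i, m t i, n t i, 0] : Fin 4 → ℝ) = 0 := fun i ↦ by
    refine eq_zero_of_linear_ode (x := fun t ↦ (![p t i, m t i, n t i, 0] : Fin 4 → ℝ)) hIc
      (contDiffOn_frameField hκ₁ hκ₂ hκ₃ (contDiffOn_const (c := 0))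
        (contDiffOn_const (c := 0))).continuousOn (fun s hs ↦ hasDerivAt_pi.2 fun j ↦ ?_) ht₀
      (by ext j; fin_cases j <;> simp [hp, hm, hn]) ht
    rw [frameField_apply]
    fin_cases j
    · simpa using h.hasDerivAt_p s hs i
    · simpa using h.hasDerivAt_m s hs i
    · simpa using h.hasDerivAt_n s hs i
    · simpa using hasDerivAt_const s (0 : ℝ)
  exact ⟨funext fun i ↦ congrFun (key i) 0, funext fun i ↦ congrFun (key i) 1,
    funext fun i ↦ congrFun (key i) 2⟩

/-- The pseudo vector product satisfies the product rule. -/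
lemma hasDerivAt_mcross {x y : ℝ → Fin 3 → ℝ} {x' y' : Fin 3 → ℝ} {t : ℝ}
    (hx : ∀ i, HasDerivAt (x · i) (x' i) t) (hy : ∀ i, HasDerivAt (y · i) (y' i) t) (i : Fin 3) :
    HasDerivAt (fun s ↦ mcross (x s) (y s) i) (mcross x' (y t) i + mcross (x t) y' i) t := by
  fin_cases i
  · convert! (((hx 1).mul (hy 2)).sub ((hx 2).mul (hy 1))).neg using 1
    simp [mcross]; ring
  · convert! ((hx 2).mul (hy 0)).sub ((hx 0).mul (hy 2)) using 1
    simp [mcross]; ring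
  · convert! ((hx 0).mul (hy 1)).sub ((hx 1).mul (hy 0)) using 1
    simp [mcross]; ring

lemma hasDerivAt_mdot {x y : ℝ → Fin 3 → ℝ} {x' y' : Fin 3 → ℝ} {t : ℝ}
    (hx : ∀ i, HasDerivAt (x · i) (x' i) t) (hy : ∀ i, HasDerivAt (y · i) (y' i) t) :
    HasDerivAt (fun s ↦ mdot (x s) (y s)) (mdot x' (y t) + mdot (x t) y') t := by
  convert! ((((hx 0).mul (hy 0)).neg).add ((hx 1).mul (hy 1))).add ((hx 2).mul (hy 2)) using 1
  simp [mdot]; ring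

/-- The relations `n = -½ ℓ⁺ ∧ ℓ⁻`, `ℓ⁺ ∧ n = -ℓ⁺`, `n ∧ ℓ⁻ = -ℓ⁻` are preserved by the frame
equations, as their defects solve the same equations. -/
lemma IsFrameSolution.mcross_defect {I : Set ℝ} {κ₁ κ₂ κ₃ : ℝ → ℝ} {p m n : ℝ → Fin 3 → ℝ}
    (h : IsFrameSolution I κ₁ κ₂ κ₃ p m n) :
    IsFrameSolution I κ₁ κ₂ κ₃ (fun t ↦ p t + mcross (p t) (n t))
      (fun t ↦ m t + mcross (n t) (m t)) (fun t ↦ n t + (1 / 2 : ℝ) • mcross (p t) (m t)) where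
  hasDerivAt_p t ht i := by
    have h₁ := (h.hasDerivAt_p t ht i).add
      (hasDerivAt_mcross (h.hasDerivAt_p t ht) (h.hasDerivAt_n t ht) i)
    refine h₁.congr_deriv ?_
    fin_cases i <;> simp [mcross] <;> ring
  hasDerivAt_m t ht i := by
    have h₁ := (h.hasDerivAt_m t ht i).add
      (hasDerivAt_mcross (h.hasDerivAt_n t ht) (h.hasDerivAt_m t ht) i)
    refine h₁.congr_deriv ?_
    fin_cases i <;> simp [mcross] <;> ring
  hasDerivAt_n t ht i := by
    have h₁ := (h.hasDerivAt_n t ht i).add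
      ((hasDerivAt_mcross (h.hasDerivAt_p t ht) (h.hasDerivAt_m t ht) i).const_mul (1 / 2))
    refine h₁.congr_deriv ?_
    fin_cases i <;> simp [mcross] <;> ring

lemma mdot_mcross_self_left (x y : Fin 3 → ℝ) : mdot (mcross x y) x = 0 := by
  simp [mdot, mcross]; ring

lemma mdot_mcross_self_right (x y : Fin 3 → ℝ) : mdot (mcross x y) y = 0 := by
  simp [mdot, mcross]; ring

lemma mdot_smul_left (c : ℝ) (x y : Fin 3 → ℝ) : mdot (c • x) y = c * mdot x y := by
  simp [mdot]; ring

/-- The frame equations with initial value a pseudo-orthonormal lightcone frame preserve such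
frames. -/
lemma IsFrameSolution.memDelta4 {I : Set ℝ} (hIo : IsOpen I) (hIc : I.OrdConnected)
    {κ₁ κ₂ κ₃ : ℝ → ℝ} (hκ₁ : Smooth1 I κ₁) (hκ₂ : Smooth1 I κ₂) (hκ₃ : Smooth1 I κ₃)
    {p m n : ℝ → Fin 3 → ℝ} (h : IsFrameSolution I κ₁ κ₂ κ₃ p m n) {t₀ : ℝ} (ht₀ : t₀ ∈ I)
    (hp : p t₀ = ![1, 1, 0]) (hm : m t₀ = ![1, -1, 0]) (hn : n t₀ = ![0, 0, 1])
    {t : ℝ} (ht : t ∈ I) :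
    MemDelta4 (p t) (m t) ∧ n t = lcn p m t := by
  have hdef : ∀ s ∈ I, _ := fun s hs ↦ h.mcross_defect.eq_zero hIc hκ₁ hκ₂ hκ₃ ht₀
    (by ext i; fin_cases i <;> simp [hp, hn, mcross])
    (by ext i; fin_cases i <;> simp [hm, hn, mcross])
    (by ext i; fin_cases i <;> simp [hp, hm, hn, mcross]; norm_num) hs
  have hpn : ∀ s ∈ I, p s = (-1 : ℝ) • mcross (p s) (n s) := fun s hs ↦ by
    simpa using eq_neg_of_add_eq_zero_left (hdef s hs).1
  have hnm : ∀ s ∈ I, m s = (-1 : ℝ) • mcross (n s) (m s) := fun s hs ↦ by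
    simpa using eq_neg_of_add_eq_zero_left (hdef s hs).2.1
  have hnpm : ∀ s ∈ I, n s = (-(1 / 2) : ℝ) • mcross (p s) (m s) := fun s hs ↦ by
    simpa using eq_neg_of_add_eq_zero_left (hdef s hs).2.2
  have hpp : mdot (p t) (p t) = 0 := by
    have h₁ := mdot_smul_left (-1) (mcross (p t) (n t)) (p t)
    rwa [← hpn t ht, mdot_mcross_self_left, mul_zero] at h₁
  have hmm : mdot (m t) (m t) = 0 := by
    have h₁ := mdot_smul_left (-1) (mcross (n t) (m t)) (m t)
    rwa [← hnm t ht, mdot_mcross_self_right, mul_zero] at h₁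
  have hpm' : ∀ s ∈ I, HasDerivAt (fun r ↦ mdot (p r) (m r)) 0 s := fun s hs ↦ by
    have h₁ : mdot (n s) (p s) = 0 := by
      rw [hnpm s hs, mdot_smul_left, mdot_mcross_self_left, mul_zero]
    have h₂ : mdot (n s) (m s) = 0 := by
      rw [hnpm s hs, mdot_smul_left, mdot_mcross_self_right, mul_zero]
    refine (hasDerivAt_mdot (h.hasDerivAt_p s hs) (h.hasDerivAt_m s hs)).congr_deriv ?_
    simp only [mdot] at h₁ h₂ ⊢
    linear_combination 2 * κ₂ s * h₁ + 2 * κ₃ s * h₂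
  have hpm : mdot (p t) (m t) = -2 := by
    rw [hIo.is_const_of_deriv_eq_zero hIc.isPreconnected
      (fun s hs ↦ (hpm' s hs).differentiableAt.differentiableWithinAt)
      (fun s hs ↦ (hpm' s hs).deriv) ht ht₀]
    simp [hp, hm, mdot]
    norm_num
  refine ⟨⟨⟨fun h0 ↦ ?_, hpp⟩, ⟨fun h0 ↦ ?_, hmm⟩, hpm⟩, hnpm t ht⟩
  · simp [h0, mdot] at hpm
  · simp [h0, mdot] at hpm

/-- Existence theorem for lightcone framed curves. -/
theorem existence_of_lightcone_framed_curves
    (I : Set ℝ) (hIo : IsOpen I) (hIc : I.OrdConnected)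
    (κ₁ κ₂ κ₃ α β : ℝ → ℝ)
    (hκ₁ : Smooth1 I κ₁) (hκ₂ : Smooth1 I κ₂) (hκ₃ : Smooth1 I κ₃)
    (hα : Smooth1 I α) (hβ : Smooth1 I β) :
    ∃ γ lp lm : ℝ → Fin 3 → ℝ,
      IsLightconeFramedCurve I γ lp lm ∧
      HasLightconeCurvature I γ lp lm κ₁ κ₂ κ₃ α β := by
  rcases I.eq_empty_or_nonempty with rfl | ⟨t₀, ht₀⟩
  · refine ⟨0, 0, 0, ⟨?_, ?_, ?_, by simp, α, β, hα, hβ, by simp⟩, hκ₁, hκ₂, hκ₃, hα, hβ,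
      by simp, by simp, by simp, by simp⟩ <;> exact contDiffOn_const
  have hA := contDiffOn_frameField hκ₁ hκ₂ hκ₃ hα hβ
  choose x hx₀ hx using fun i : Fin 3 ↦ exists_linear_ode_solution hIo hIc hA.continuousOn ht₀
    ![![1, 1, 0] i, ![1, -1, 0] i, ![0, 0, 1] i, 0]
  have hsm : ∀ j, Smooth3 I (fun t i ↦ x i t j) := fun j ↦ contDiffOn_pi.2 fun i ↦
    contDiffOn_pi.1 (contDiffOn_of_linear_ode hIo hA (hx i)) j
  have hxd : ∀ t ∈ I, ∀ i j, HasDerivAt (x i · j) _ t := fun t ht i j ↦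
    hasDerivAt_pi.1 (hx i t ht) j
  simp only [frameField_apply] at hxd
  have hF : IsFrameSolution I κ₁ κ₂ κ₃ (fun t i ↦ x i t 0) (fun t i ↦ x i t 1)
      (fun t i ↦ x i t 2) :=
    ⟨fun t ht i ↦ hxd t ht i 0, fun t ht i ↦ hxd t ht i 1, fun t ht i ↦ hxd t ht i 2⟩
  have hΔ : ∀ t ∈ I, _ := fun t ht ↦ hF.memDelta4 hIo hIc hκ₁ hκ₂ hκ₃ ht₀
    (by ext i; simp [hx₀]) (by ext i; simp [hx₀]) (by ext i; simp [hx₀]) ht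
  have hbase : ∀ t ∈ I, deriv (fun t i ↦ x i t 3) t =
      α t • (fun i ↦ x i t 0) + β t • (fun i ↦ x i t 1) := fun t ht ↦
    (hasDerivAt_pi.2 fun i ↦ hxd t ht i 3).deriv
  refine ⟨fun t i ↦ x i t 3, fun t i ↦ x i t 0, fun t i ↦ x i t 1,
    ⟨hsm 3, hsm 0, hsm 1, fun t ht ↦ (hΔ t ht).1, α, β, hα, hβ, hbase⟩,
    hκ₁, hκ₂, hκ₃, hα, hβ, fun t ht ↦ ?_, fun t ht ↦ ?_, fun t ht ↦ ?_, hbase⟩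
  · rw [← (hΔ t ht).2]
    exact (hasDerivAt_pi.2 fun i ↦ hxd t ht i 0).deriv
  · rw [← (hΔ t ht).2]
    exact (hasDerivAt_pi.2 fun i ↦ hxd t ht i 1).deriv
  · rw [Filter.EventuallyEq.deriv_eq
      ((hIo.eventually_mem ht).mono fun s hs ↦ (hΔ s hs).2.symm)]
    exact (hasDerivAt_pi.2 fun i ↦ hxd t ht i 2).deriv
end
end

section
/- Uniqueness theorem for lightcone framed curves: two lightcone framed curves (γ,ℓ⁺,ℓ⁻) and (γ̄,ℓ̄⁺,ℓ̄⁻) : I → ℝ³₁ × Δ₄ with lightcone curvatures (κ₁,κ₂,κ₃,α,β) and (κ̄₁,κ̄₂,κ̄₃,ᾱ,β̄) are congruent as lightcone framed curves — i.e. there exist A ∈ SO(1,2) and a ∈ ℝ³₁ with γ̄(t) = A(γ(t)) + a, ℓ̄⁺(t) = A(ℓ⁺(t)), ℓ̄⁻(t) = A(ℓ⁻(t)) for all t ∈ I — if and only if (κ₁,κ₂,κ₃,α,β) = (κ̄₁,κ̄₂,κ̄₃,ᾱ,β̄) as functions on I. -/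
open Matrix

noncomputable section

/-- The matrix `Z = diag(−1,1,1)`. -/
def minkZ : Matrix (Fin 3) (Fin 3) ℝ := Matrix.diagonal ![-1, 1, 1]

/-- `A ∈ SO(1,2)`. -/
def SO12 (A : Matrix (Fin 3) (Fin 3) ℝ) : Prop := Aᵀ * minkZ * A = minkZ ∧ A.det = 1

/-- Congruence of lightcone framed curves. -/
def CongruentLFC (I : Set ℝ) (γ lp lm γ' lp' lm' : ℝ → Fin 3 → ℝ) : Prop :=
  ∃ A : Matrix (Fin 3) (Fin 3) ℝ, SO12 A ∧ ∃ a : Fin 3 → ℝ,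
    ∀ t ∈ I, γ' t = A.mulVec (γ t) + a ∧ lp' t = A.mulVec (lp t) ∧
      lm' t = A.mulVec (lm t)

/-- The matrix whose columns are `v`, `w` and `−(1/2) v ∧ w`. -/
def lightconeFrame (v w : Fin 3 → ℝ) : Matrix (Fin 3) (Fin 3) ℝ :=
  Matrix.of fun i j => ![v i, w i, -(1/2) * mcross v w i] j

/-- The Gram matrix of a lightcone frame. -/
def lightconeGram : Matrix (Fin 3) (Fin 3) ℝ := !![0, -2, 0; -2, 0, 0; 0, 0, 1]

/-- The inverse of the Gram matrix of a lightcone frame. -/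
def lightconeGramInv : Matrix (Fin 3) (Fin 3) ℝ := !![0, -(1/2), 0; -(1/2), 0, 0; 0, 0, 1]

theorem lightconeGramInv_mul_gram : lightconeGramInv * lightconeGram = 1 := by
  ext i j
  fin_cases i <;> fin_cases j <;>
    simp [lightconeGramInv, lightconeGram, Matrix.mul_apply, Fin.sum_univ_three]

theorem lightconeFrame_gram {v w : Fin 3 → ℝ} (h : MemDelta4 v w) :
    (lightconeFrame v w)ᵀ * minkZ * lightconeFrame v w = lightconeGram := by
  obtain ⟨⟨-, hv⟩, ⟨-, hw⟩, hvw⟩ := h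
  simp only [mdot] at hv hw hvw
  ext i j
  fin_cases i <;> fin_cases j <;>
    simp [lightconeFrame, lightconeGram, minkZ, mcross, Matrix.mul_apply,
      Fin.sum_univ_three, Matrix.diagonal_apply] <;> grind

theorem lightconeFrame_det {v w : Fin 3 → ℝ} (h : MemDelta4 v w) :
    (lightconeFrame v w).det = -2 := by
  obtain ⟨⟨-, hv⟩, ⟨-, hw⟩, hvw⟩ := h
  simp only [mdot] at hv hw hvw
  simp [Matrix.det_fin_three, lightconeFrame, mcross]
  grind

/-- The matrix carrying the lightcone frame of `(v, w)` to that of `(v', w')`. -/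
def frameTransfer (v w v' w' : Fin 3 → ℝ) : Matrix (Fin 3) (Fin 3) ℝ :=
  lightconeFrame v' w' * lightconeGramInv * (lightconeFrame v w)ᵀ * minkZ

theorem frameTransfer_mul {v w v' w' : Fin 3 → ℝ} (h : MemDelta4 v w) :
    frameTransfer v w v' w' * lightconeFrame v w = lightconeFrame v' w' := by
  have h1 := lightconeFrame_gram h
  rw [frameTransfer, Matrix.mul_assoc, Matrix.mul_assoc, Matrix.mul_assoc,
    ← Matrix.mul_assoc _ minkZ, h1, lightconeGramInv_mul_gram, Matrix.mul_one]

theorem frameTransfer_mulVec {v w v' w' : Fin 3 → ℝ} (h : MemDelta4 v w) :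
    frameTransfer v w v' w' *ᵥ v = v' ∧ frameTransfer v w v' w' *ᵥ w = w' := by
  have h1 := frameTransfer_mul (v' := v') (w' := w') h
  constructor
  · ext i
    simpa [lightconeFrame, Matrix.mul_apply, Matrix.mulVec, dotProduct]
      using congrFun (congrFun h1 i) 0
  · ext i
    simpa [lightconeFrame, Matrix.mul_apply, Matrix.mulVec, dotProduct]
      using congrFun (congrFun h1 i) 1

theorem frameTransfer_SO12 {v w v' w' : Fin 3 → ℝ} (h : MemDelta4 v w)
    (h' : MemDelta4 v' w') : SO12 (frameTransfer v w v' w') := by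
  have h1 := frameTransfer_mul (v' := v') (w' := w') h
  set A := frameTransfer v w v' w'
  have hd := lightconeFrame_det h
  have hd' := lightconeFrame_det h'
  have hg := lightconeFrame_gram h
  have hg' := lightconeFrame_gram h'
  have hu : IsUnit (lightconeFrame v w) := by
    rw [Matrix.isUnit_iff_isUnit_det, hd]
    norm_num
  have hu' : IsUnit (lightconeFrame v w)ᵀ := by
    rw [Matrix.isUnit_iff_isUnit_det, Matrix.det_transpose, hd]
    norm_num
  constructor
  · apply hu'.mul_left_cancel
    apply hu.mul_right_cancel
    rw [hg, ← hg', ← h1, Matrix.transpose_mul]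
    simp only [Matrix.mul_assoc]
  · have h2 := congrArg Matrix.det h1
    rw [Matrix.det_mul, hd, hd'] at h2
    linarith

theorem SO12.mcross_mulVec {A : Matrix (Fin 3) (Fin 3) ℝ} (hA : SO12 A) (x y : Fin 3 → ℝ) :
    mcross (A *ᵥ x) (A *ᵥ y) = A *ᵥ mcross x y := by
  obtain ⟨h1, h2⟩ := hA
  have hadj : minkZ * A.adjugate = Aᵀ * minkZ := by
    have := congrArg (· * A.adjugate) h1
    simpa [Matrix.mul_assoc, Matrix.mul_adjugate, h2] using this.symm
  have e (i j : Fin 3) := congrFun (congrFun hadj i) j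
  simp only [Matrix.adjugate_fin_three, minkZ, Matrix.diagonal_mul, Matrix.mul_diagonal] at e
  ext i
  have e0 := e 0 i
  have e1 := e 1 i
  have e2 := e 2 i
  fin_cases i <;>
    simp [mcross, Matrix.mulVec, dotProduct, Fin.sum_univ_three] at e0 e1 e2 ⊢ <;> grind

theorem IsLightconeFramedCurve.differentiableAt {I : Set ℝ} (hIo : IsOpen I)
    {γ lp lm : ℝ → Fin 3 → ℝ} (hF : IsLightconeFramedCurve I γ lp lm) {t : ℝ} (ht : t ∈ I) :
    DifferentiableAt ℝ γ t ∧ DifferentiableAt ℝ lp t ∧ DifferentiableAt ℝ lm t := by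
  have key {f : ℝ → Fin 3 → ℝ} (hf : Smooth3 I f) : DifferentiableAt ℝ f t :=
    (ContDiffOn.differentiableOn hf (by simp)).differentiableAt (hIo.mem_nhds ht)
  exact ⟨key hF.smooth_base, key hF.smooth_lp, key hF.smooth_lm⟩

theorem differentiableAt_lcn {lp lm : ℝ → Fin 3 → ℝ} {t : ℝ} (hp : DifferentiableAt ℝ lp t)
    (hm : DifferentiableAt ℝ lm t) : DifferentiableAt ℝ (lcn lp lm) t := by
  rw [differentiableAt_pi] at hp hm ⊢
  have p0 := hp 0
  have p1 := hp 1
  have p2 := hp 2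
  have m0 := hm 0
  have m1 := hm 1
  have m2 := hm 2
  intro i
  fin_cases i <;> simp [lcn, mcross] <;> fun_prop

theorem hasDerivAt_mulVec {A : Matrix (Fin 3) (Fin 3) ℝ} {f : ℝ → Fin 3 → ℝ} {t : ℝ}
    (hf : DifferentiableAt ℝ f t) : HasDerivAt (fun s => A *ᵥ f s) (A *ᵥ deriv f t) t :=
  (LinearMap.toContinuousLinearMap A.mulVecLin).hasFDerivAt.comp_hasDerivAt t hf.hasDerivAt

theorem lightconeFrame_coeffs {v w : Fin 3 → ℝ} (h : MemDelta4 v w) {a b c a' b' c' : ℝ}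
    (e : a • v + b • w + c • ((-(1/2) : ℝ) • mcross v w) =
      a' • v + b' • w + c' • ((-(1/2) : ℝ) • mcross v w)) : a = a' ∧ b = b' ∧ c = c' := by
  have hu : IsUnit (lightconeFrame v w) := by
    rw [Matrix.isUnit_iff_isUnit_det, lightconeFrame_det h]
    norm_num
  have key : lightconeFrame v w *ᵥ ![a, b, c] = lightconeFrame v w *ᵥ ![a', b', c'] := by
    ext i
    have := congrFun e i
    simp [lightconeFrame, Matrix.mulVec, dotProduct, Fin.sum_univ_three] at this ⊢
    linarith
  have := Matrix.mulVec_injective_of_isUnit hu key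
  exact ⟨congrFun this 0, congrFun this 1, congrFun this 2⟩

theorem hasDerivAt_frameTransfer_apply {I : Set ℝ} (hIo : IsOpen I)
    {γ lp lm γ' lp' lm' : ℝ → Fin 3 → ℝ} {κ₁ κ₂ κ₃ α β α' β' : ℝ → ℝ}
    {κ₁' κ₂' κ₃' : ℝ → ℝ}
    (hF : IsLightconeFramedCurve I γ lp lm) (hF' : IsLightconeFramedCurve I γ' lp' lm')
    (hC : HasLightconeCurvature I γ lp lm κ₁ κ₂ κ₃ α β)
    (hC' : HasLightconeCurvature I γ' lp' lm' κ₁' κ₂' κ₃' α' β')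
    {t : ℝ} (ht : t ∈ I) (h₁ : κ₁ t = κ₁' t) (h₂ : κ₂ t = κ₂' t) (h₃ : κ₃ t = κ₃' t)
    (i j : Fin 3) :
    HasDerivAt (fun s => frameTransfer (lp s) (lm s) (lp' s) (lm' s) i j) 0 t := by
  obtain ⟨-, hp, hm⟩ := hF.differentiableAt hIo ht
  obtain ⟨-, hp', hm'⟩ := hF'.differentiableAt hIo ht
  have hn := (differentiableAt_lcn hp hm).hasDerivAt
  have hn' := (differentiableAt_lcn hp' hm').hasDerivAt
  replace hp := hp.hasDerivAt
  replace hm := hm.hasDerivAt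
  replace hp' := hp'.hasDerivAt
  replace hm' := hm'.hasDerivAt
  rw [hC.deriv_lp t ht] at hp
  rw [hC.deriv_lm t ht] at hm
  rw [hC.deriv_n t ht] at hn
  rw [hC'.deriv_lp t ht, ← h₁, ← h₃] at hp'
  rw [hC'.deriv_lm t ht, ← h₁, ← h₂] at hm'
  rw [hC'.deriv_n t ht, ← h₂, ← h₃] at hn'
  rw [hasDerivAt_pi] at hp hm hn hp' hm' hn'
  have e : (fun s => frameTransfer (lp s) (lm s) (lp' s) (lm' s) i j) =
      fun s => (-(1/2) * (lp' s i * lm s j + lm' s i * lp s j)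
        + lcn lp' lm' s i * lcn lp lm s j) * ![-1, 1, 1] j := by
    funext s
    rw [frameTransfer, minkZ, Matrix.mul_diagonal]
    congr 1
    simp [lightconeFrame, lightconeGramInv, lcn, Matrix.mul_apply, Fin.sum_univ_three]
    ring
  rw [e]
  refine ((((((hp' i).mul (hm j)).add ((hm' i).mul (hp j))).const_mul (-(1/2) : ℝ)).add
    ((hn' i).mul (hn j))).mul_const (![-1, 1, 1] j)).congr_deriv ?_
  simp only [Pi.add_apply, Pi.smul_apply, smul_eq_mul]
  ring

/-- Uniqueness theorem for lightcone framed curves. -/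
theorem uniqueness_of_lightcone_framed_curves
    (I : Set ℝ) (hIo : IsOpen I) (hIc : I.OrdConnected)
    (γ lp lm γ' lp' lm' : ℝ → Fin 3 → ℝ)
    (κ₁ κ₂ κ₃ α β κ₁' κ₂' κ₃' α' β' : ℝ → ℝ)
    (hF : IsLightconeFramedCurve I γ lp lm)
    (hF' : IsLightconeFramedCurve I γ' lp' lm')
    (hC : HasLightconeCurvature I γ lp lm κ₁ κ₂ κ₃ α β)
    (hC' : HasLightconeCurvature I γ' lp' lm' κ₁' κ₂' κ₃' α' β') :
    CongruentLFC I γ lp lm γ' lp' lm' ↔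
      ∀ t ∈ I, κ₁ t = κ₁' t ∧ κ₂ t = κ₂' t ∧ κ₃ t = κ₃' t ∧
        α t = α' t ∧ β t = β' t := by
  constructor
  · rintro ⟨A, hA, a, hcong⟩ t ht
    obtain ⟨hγ, hp, hm⟩ := hF.differentiableAt hIo ht
    have hn := differentiableAt_lcn hp hm
    have hev {f : ℝ → Fin 3 → ℝ} {g : ℝ → Fin 3 → ℝ} (h : ∀ s ∈ I, f s = g s) :
        deriv f t = deriv g t :=
      Filter.EventuallyEq.deriv_eq (Filter.eventually_of_mem (hIo.mem_nhds ht) h)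
    have hcn (s : ℝ) (hs : s ∈ I) : lcn lp' lm' s = A *ᵥ lcn lp lm s := by
      rw [lcn, (hcong s hs).2.1, (hcong s hs).2.2, hA.mcross_mulVec, lcn, Matrix.mulVec_smul]
    have dγ := (hev fun s hs => (hcong s hs).1).trans ((hasDerivAt_mulVec hγ).add_const a).deriv
    have dp := (hev fun s hs => (hcong s hs).2.1).trans (hasDerivAt_mulVec hp).deriv
    have dn := (hev hcn).trans (hasDerivAt_mulVec hn).deriv
    rw [hC'.deriv_base t ht, hC.deriv_base t ht] at dγ
    rw [hC'.deriv_lp t ht, hC.deriv_lp t ht] at dp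
    rw [hC'.deriv_n t ht, hC.deriv_n t ht] at dn
    simp only [Matrix.mulVec_add, Matrix.mulVec_smul, ← hcn t ht, ← (hcong t ht).2.1,
      ← (hcong t ht).2.2] at dγ dp dn
    have hΔ := hF'.delta4 t ht
    have cγ := lightconeFrame_coeffs hΔ (c := 0) (c' := 0) (by simpa using dγ)
    have cp := lightconeFrame_coeffs hΔ (b := 0) (b' := 0) (by simpa [lcn] using dp)
    have cn := lightconeFrame_coeffs hΔ (c := 0) (c' := 0) (by simpa using dn)
    exact ⟨cp.1.symm, cn.1.symm, cn.2.1.symm, cγ.1.symm, cγ.2.1.symm⟩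
  · intro h
    rcases I.eq_empty_or_nonempty with rfl | ⟨t₀, ht₀⟩
    · exact ⟨1, by simp [SO12], 0, by simp⟩
    have hconst (t : ℝ) (ht : t ∈ I) : frameTransfer (lp t) (lm t) (lp' t) (lm' t) =
        frameTransfer (lp t₀) (lm t₀) (lp' t₀) (lm' t₀) := by
      ext i j
      have hd (s : ℝ) (hs : s ∈ I) := hasDerivAt_frameTransfer_apply hIo hF hF' hC hC' hs
        (h s hs).1 (h s hs).2.1 (h s hs).2.2.1 i j
      exact hIo.is_const_of_deriv_eq_zero hIc.isPreconnected
        (fun s hs => (hd s hs).differentiableAt.differentiableWithinAt)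
        (fun s hs => (hd s hs).deriv) ht ht₀
    set A := frameTransfer (lp t₀) (lm t₀) (lp' t₀) (lm' t₀)
    have hA (t : ℝ) (ht : t ∈ I) : A *ᵥ lp t = lp' t ∧ A *ᵥ lm t = lm' t :=
      hconst t ht ▸ frameTransfer_mulVec (hF.delta4 t ht)
    refine ⟨A, frameTransfer_SO12 (hF.delta4 t₀ ht₀) (hF'.delta4 t₀ ht₀),
      γ' t₀ - A *ᵥ γ t₀, fun t ht => ⟨?_, (hA t ht).1.symm, (hA t ht).2.symm⟩⟩
    have hd (s : ℝ) (hs : s ∈ I) : HasDerivAt (fun s => γ' s - A *ᵥ γ s) 0 s := by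
      refine ((hF'.differentiableAt hIo hs).1.hasDerivAt.sub
        (hasDerivAt_mulVec (A := A) (hF.differentiableAt hIo hs).1)).congr_deriv ?_
      rw [hC'.deriv_base s hs, hC.deriv_base s hs, Matrix.mulVec_add, Matrix.mulVec_smul,
        Matrix.mulVec_smul, (hA s hs).1, (hA s hs).2, (h s hs).2.2.2.1, (h s hs).2.2.2.2, sub_self]
    have := hIo.is_const_of_deriv_eq_zero hIc.isPreconnected
      (fun s hs => (hd s hs).differentiableAt.differentiableWithinAt)
      (fun s hs => (hd s hs).deriv) ht ht₀
    rw [← this]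
    abel
end
end

section
/- Suppose (γ,ℓ⁺,ℓ⁻) : I → ℝ³₁ × Δ₄ is a lightcone framed curve with lightcone curvature (κ₁,κ₂,κ₃,α,β) and there exist smooth functions λ, k : I → ℝ with λ ≢ 0 and k(t)β(t) = λ(t)κ₃(t) for all t ∈ I. Then (γ̄,ℓ̄⁺,ℓ̄⁻) defined by γ̄(t) = γ(t) + λ(t)ℓ⁺(t), ℓ̄⁺(t) = ℓ⁺(t), ℓ̄⁻(t) = k²(t)ℓ⁺(t) + ℓ⁻(t) + 2k(t)n(t) is a lightcone framed curve whose lightcone curvature (κ̄₁,κ̄₂,κ̄₃,ᾱ,β̄) is given by κ̄₁ = κ₁ − 2κ₃k, κ̄₂ = k' + κ₁k + κ₂ − κ₃k², κ̄₃ = κ₃, ᾱ = α + λ' + λκ₁ − βk², β̄ = β. -/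
open Matrix

noncomputable section

lemma mcross_lcn {lp lm : ℝ → Fin 3 → ℝ} {t : ℝ} (h : MemDelta4 (lp t) (lm t)) :
    mcross (lp t) (lcn lp lm t) = -lp t := by
  obtain ⟨⟨-, h1⟩, -, h3⟩ := h
  simp only [mdot] at h1 h3
  ext i
  fin_cases i <;> simp [mcross, lcn]
  · linear_combination (-(lm t 0) / 2) * h1 + (lp t 0 / 2) * h3
  · linear_combination (-(lm t 1) / 2) * h1 + (lp t 1 / 2) * h3
  · linear_combination (-(lm t 2) / 2) * h1 + (lp t 2 / 2) * h3

lemma mcross_self (x : Fin 3 → ℝ) : mcross x x = 0 := by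
  ext i
  fin_cases i <;> simp [mcross] <;> ring

lemma mcross_add_right (x y z : Fin 3 → ℝ) : mcross x (y + z) = mcross x y + mcross x z := by
  ext i
  fin_cases i <;> simp [mcross] <;> ring

lemma mcross_smul_right (a : ℝ) (x y : Fin 3 → ℝ) : mcross x (a • y) = a • mcross x y := by
  ext i
  fin_cases i <;> simp [mcross] <;> ring

/-- The normal field of the frame obtained from `(ℓ⁺, ℓ⁻)` by the null rotation fixing `ℓ⁺`. -/
lemma lcn_nullRotation {lp lm : ℝ → Fin 3 → ℝ} (k : ℝ → ℝ) {t : ℝ}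
    (h : MemDelta4 (lp t) (lm t)) :
    lcn lp (fun t => (k t) ^ 2 • lp t + lm t + (2 * k t) • lcn lp lm t) t
      = lcn lp lm t + k t • lp t := by
  have hn : lcn lp lm t = (-(1/2) : ℝ) • mcross (lp t) (lm t) := rfl
  change (-(1/2) : ℝ) • mcross (lp t) _ = _
  rw [mcross_add_right, mcross_add_right, mcross_smul_right, mcross_smul_right, mcross_self,
    mcross_lcn h, hn]
  module

lemma MemDelta4.nullRotation {lp lm : ℝ → Fin 3 → ℝ} (k : ℝ) {t : ℝ}
    (h : MemDelta4 (lp t) (lm t)) :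
    MemDelta4 (lp t) (k ^ 2 • lp t + lm t + (2 * k) • lcn lp lm t) := by
  obtain ⟨⟨h0, h1⟩, ⟨-, h2⟩, h3⟩ := h
  have hd : mdot (lp t) (k ^ 2 • lp t + lm t + (2 * k) • lcn lp lm t) = -2 := by
    simp only [mdot] at h1 h3 ⊢
    simp [lcn, mcross]
    linear_combination k ^ 2 * h1 + h3
  refine ⟨⟨h0, h1⟩, ⟨fun hz => ?_, ?_⟩, hd⟩
  · rw [hz] at hd
    simp [mdot] at hd
  · have hnn : mdot (lcn lp lm t) (lcn lp lm t) = 1 := by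
      have : mdot (lcn lp lm t) (lcn lp lm t)
          = (mdot (lp t) (lm t) ^ 2 - mdot (lp t) (lp t) * mdot (lm t) (lm t)) / 4 := by
        simp [mdot, lcn, mcross]
        ring
      rw [this, h1, h3]
      norm_num
    have hpn : mdot (lp t) (lcn lp lm t) = 0 := by
      simp [mdot, lcn, mcross]
      ring
    have hmn : mdot (lm t) (lcn lp lm t) = 0 := by
      simp [mdot, lcn, mcross]
      ring
    have hexp : ∀ (a b : ℝ) (x y z : Fin 3 → ℝ), mdot (a • x + y + b • z) (a • x + y + b • z)
        = a ^ 2 * mdot x x + mdot y y + b ^ 2 * mdot z z + 2 * a * mdot x y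
          + 2 * a * b * mdot x z + 2 * b * mdot y z := by
      intro a b x y z
      simp [mdot]
      ring
    rw [hexp, h1, h2, h3, hnn, hpn, hmn]
    ring

lemma smooth3_lcn {I : Set ℝ} {lp lm : ℝ → Fin 3 → ℝ} (hp : Smooth3 I lp) (hm : Smooth3 I lm) :
    Smooth3 I (lcn lp lm) := by
  have hp' := contDiffOn_pi.1 hp
  have hm' := contDiffOn_pi.1 hm
  refine contDiffOn_pi.2 fun i => ?_
  have hij : ∀ i j, ContDiffOn ℝ (⊤ : ℕ∞) (fun t => lp t i * lm t j) I :=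
    fun i j => (hp' i).mul (hm' j)
  fin_cases i <;> simp only [lcn, mcross, Pi.smul_apply, smul_eq_mul]
  · exact contDiffOn_const.mul ((hij 1 2).sub (hij 2 1)).neg
  · exact contDiffOn_const.mul ((hij 2 0).sub (hij 0 2))
  · exact contDiffOn_const.mul ((hij 0 1).sub (hij 1 0))

lemma ContDiffOn.hasDerivAt_of_isOpen {E : Type*} [NormedAddCommGroup E] [NormedSpace ℝ E]
    {I : Set ℝ} {f : ℝ → E} (h : ContDiffOn ℝ (⊤ : ℕ∞) f I) (hI : IsOpen I) {t : ℝ}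
    (ht : t ∈ I) : HasDerivAt f (deriv f t) t :=
  ((h.differentiableOn (by simp)).differentiableAt (hI.mem_nhds ht)).hasDerivAt

/-- Curvature of the `(ℓ⁺,ℓ̄⁺)`-mate. -/
theorem curvature_lp_lpbar_mate
    (I : Set ℝ) (hIo : IsOpen I) (hIc : I.OrdConnected)
    (γ lp lm : ℝ → Fin 3 → ℝ) (κ₁ κ₂ κ₃ α β : ℝ → ℝ)
    (hF : IsLightconeFramedCurve I γ lp lm)
    (hC : HasLightconeCurvature I γ lp lm κ₁ κ₂ κ₃ α β)
    (lam k : ℝ → ℝ) (hlam : Smooth1 I lam) (hk : Smooth1 I k)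
    (hne : NotIdentZero I lam)
    (hrel : ∀ t ∈ I, k t * β t = lam t * κ₃ t) :
    IsLightconeFramedCurve I (fun t => γ t + lam t • lp t) lp
      (fun t => (k t) ^ 2 • lp t + lm t + (2 * k t) • lcn lp lm t) ∧
    HasLightconeCurvature I (fun t => γ t + lam t • lp t) lp
      (fun t => (k t) ^ 2 • lp t + lm t + (2 * k t) • lcn lp lm t)
      (fun t => κ₁ t - 2 * κ₃ t * k t)
      (fun t => deriv k t + κ₁ t * k t + κ₂ t - κ₃ t * (k t) ^ 2)
      κ₃
      (fun t => α t + deriv lam t + lam t * κ₁ t - β t * (k t) ^ 2)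
      β := by
  have hsn := smooth3_lcn hF.smooth_lp hF.smooth_lm
  have hdk : Smooth1 I (deriv k) := hk.deriv_of_isOpen hIo (by simp)
  have hdlam : Smooth1 I (deriv lam) := hlam.deriv_of_isOpen hIo (by simp)
  have hα : Smooth1 I (fun t => α t + deriv lam t + lam t * κ₁ t - β t * (k t) ^ 2) :=
    ((hC.smooth_α.add hdlam).add (hlam.mul hC.smooth_κ₁)).sub (hC.smooth_β.mul (hk.pow 2))
  have hbase : ∀ t ∈ I, deriv (fun t => γ t + lam t • lp t) t
      = (α t + deriv lam t + lam t * κ₁ t - β t * (k t) ^ 2) • lp t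
        + β t • ((k t) ^ 2 • lp t + lm t + (2 * k t) • lcn lp lm t) := by
    intro t ht
    have h := (hF.smooth_base.hasDerivAt_of_isOpen hIo ht).add
      ((hlam.hasDerivAt_of_isOpen hIo ht).smul (hF.smooth_lp.hasDerivAt_of_isOpen hIo ht))
    refine h.deriv.trans ?_
    rw [hC.deriv_base t ht, hC.deriv_lp t ht]
    have hr : (2 * (lam t * κ₃ t)) • lcn lp lm t = (2 * (k t * β t)) • lcn lp lm t := by
      rw [hrel t ht]
    linear_combination (norm := module) hr
  refine ⟨⟨hF.smooth_base.add (hlam.smul hF.smooth_lp), hF.smooth_lp,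
    (((hk.pow 2).smul hF.smooth_lp).add hF.smooth_lm).add ((contDiffOn_const.mul hk).smul hsn),
    fun t ht => (hF.delta4 t ht).nullRotation (k t), _, β, hα, hC.smooth_β, hbase⟩,
    ⟨hC.smooth_κ₁.sub ((contDiffOn_const.mul hC.smooth_κ₃).mul hk),
    ((hdk.add (hC.smooth_κ₁.mul hk)).add hC.smooth_κ₂).sub (hC.smooth_κ₃.mul (hk.pow 2)),
    hC.smooth_κ₃, hα, hC.smooth_β, fun t ht => ?_, fun t ht => ?_, fun t ht => ?_, hbase⟩⟩
  · rw [lcn_nullRotation k (hF.delta4 t ht), hC.deriv_lp t ht]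
    module
  · have hk' := hk.hasDerivAt_of_isOpen hIo ht
    have h := (((hk'.pow 2).smul (hF.smooth_lp.hasDerivAt_of_isOpen hIo ht)).add
      (hF.smooth_lm.hasDerivAt_of_isOpen hIo ht)).add
      ((hk'.const_mul 2).smul (hsn.hasDerivAt_of_isOpen hIo ht))
    rw [lcn_nullRotation k (hF.delta4 t ht)]
    refine h.deriv.trans ?_
    rw [hC.deriv_lp t ht, hC.deriv_lm t ht, hC.deriv_n t ht]
    simp only [Pi.pow_apply]
    push_cast
    module
  · have heq : lcn lp (fun t => (k t) ^ 2 • lp t + lm t + (2 * k t) • lcn lp lm t)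
        =ᶠ[nhds t] fun t => lcn lp lm t + k t • lp t :=
      Filter.eventually_of_mem (hIo.mem_nhds ht) fun s hs => lcn_nullRotation k (hF.delta4 s hs)
    rw [heq.deriv_eq]
    have h := (hsn.hasDerivAt_of_isOpen hIo ht).add
      ((hk.hasDerivAt_of_isOpen hIo ht).smul (hF.smooth_lp.hasDerivAt_of_isOpen hIo ht))
    refine h.deriv.trans ?_
    rw [hC.deriv_lp t ht, hC.deriv_n t ht]
    module
end
end
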